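/- The pair (U, V) is a traveling-band solution of the reduced chemotaxis system with unlimited substrate: for every ζ ∈ ℝ one has τ c U′(ζ) − β (U·V′/V)′(ζ) + (μ/2) U″(ζ) = 0 and c V′(ζ) − k U(ζ) = 0. -/

import Mathlib

open Real Filter

/-- The pair (U, V) is a traveling-band solution of the reduced chemotaxis system
with unlimited substrate (case d = 2β/μ > 1). -/
theorem unlimited_substrate_traveling_band
    (τ β μ k c Vinf C0 d : ℝ)
    (hτ : 0 < τ) (hβ : 0 < β) (hμ : 0 < μ) (hk : 0 < k) (hc : 0 < c)
    (hVinf : 0 < Vinf) (hC0 : 0 < C0)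
    (hd : d = 2 * β / μ) (hd1 : 1 < d)
    (V U : ℝ → ℝ)
    (hV : ∀ ζ : ℝ, V ζ =
      ((C0 * k * μ * (d - 1)) / (2 * c ^ 2 * τ) * Real.exp (-(2 * τ * c * ζ) / μ)
        + Vinf ^ (-(d - 1))) ^ (-(1 / (d - 1))))
    (hU : ∀ ζ : ℝ, U ζ = C0 * V ζ ^ d * Real.exp (-(2 * τ * c * ζ) / μ)) :
    ∀ ζ : ℝ,
      τ * c * deriv U ζ - β * deriv (fun s => U s * deriv V s / V s) ζ
          + μ / 2 * deriv (deriv U) ζ = 0 ∧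
      c * deriv V ζ - k * U ζ = 0 := by
  have hd0 : d - 1 ≠ 0 := by linarith
  have hdp : d ≠ 0 := by linarith
  have hWpos : ∀ ζ : ℝ, 0 < (C0 * k * μ * (d - 1)) / (2 * c ^ 2 * τ) *
      Real.exp (-(2 * τ * c * ζ) / μ) + Vinf ^ (-(d - 1)) := by
    intro ζ
    have h1 : 0 < d - 1 := by linarith
    have h2 : 0 < Vinf ^ (-(d - 1)) := Real.rpow_pos_of_pos hVinf _
    positivity
  have hVpos : ∀ ζ, 0 < V ζ := by
    intro ζ
    rw [hV]
    exact Real.rpow_pos_of_pos (hWpos ζ) _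
  have hE : ∀ ζ : ℝ, HasDerivAt (fun s : ℝ => Real.exp (-(2 * τ * c * s) / μ))
      (Real.exp (-(2 * τ * c * ζ) / μ) * (-(2 * τ * c) / μ)) ζ := by
    intro ζ
    have h : HasDerivAt (fun s : ℝ => -(2 * τ * c * s) / μ) (-(2 * τ * c) / μ) ζ := by
      have := (((hasDerivAt_id ζ).const_mul (2 * τ * c)).neg).div_const μ
      simpa using this
    exact h.exp
  have hV' : ∀ ζ, HasDerivAt V (k / c * U ζ) ζ := by
    intro ζ
    have h := (((hE ζ).const_mul ((C0 * k * μ * (d - 1)) / (2 * c ^ 2 * τ))).add_const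
      (Vinf ^ (-(d - 1)))).rpow_const (p := -(1 / (d - 1))) (Or.inl (hWpos ζ).ne')
    have hVf : V = fun ζ => ((C0 * k * μ * (d - 1)) / (2 * c ^ 2 * τ) *
        Real.exp (-(2 * τ * c * ζ) / μ) + Vinf ^ (-(d - 1))) ^ (-(1 / (d - 1))) := funext hV
    have hp : V ζ ^ d = ((C0 * k * μ * (d - 1)) / (2 * c ^ 2 * τ) *
        Real.exp (-(2 * τ * c * ζ) / μ) + Vinf ^ (-(d - 1))) ^ (-(1 / (d - 1)) - 1) := by
      rw [hV, ← Real.rpow_mul (hWpos ζ).le]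
      congr 1
      field_simp
      ring
    rw [hU, hp, hVf]
    refine h.congr_deriv ?_
    generalize (_ : ℝ) ^ (-(1 / (d - 1)) - 1) = X
    generalize Real.exp _ = Y
    field_simp
  have hdV : deriv V = fun ζ => k / c * U ζ := funext fun ζ => (hV' ζ).deriv
  have hUf : U = fun ζ => C0 * V ζ ^ d * Real.exp (-(2 * τ * c * ζ) / μ) := funext hU
  have hU' : ∀ ζ, HasDerivAt U (d * (U ζ * deriv V ζ / V ζ) - 2 * τ * c / μ * U ζ) ζ := by
    intro ζ
    have h := ((((hV' ζ).rpow_const (p := d) (Or.inl (hVpos ζ).ne')).const_mul C0).mul (hE ζ))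
    have h2 : HasDerivAt U _ ζ := h.congr_of_eventuallyEq (Eventually.of_forall hU)
    refine h2.congr_deriv ?_
    have hv := (hVpos ζ).ne'
    rw [(hV' ζ).deriv, Real.rpow_sub_one hv, hU ζ]
    field_simp
    ring
  have hdU : deriv U = fun ζ => d * (U ζ * deriv V ζ / V ζ) - 2 * τ * c / μ * U ζ :=
    funext fun ζ => (hU' ζ).deriv
  intro ζ
  have hG : DifferentiableAt ℝ (fun s => U s * deriv V s / V s) ζ := by
    rw [hdV]
    exact ((hU' ζ).differentiableAt.mul ((hU' ζ).differentiableAt.const_mul _)).div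
      (hV' ζ).differentiableAt (hVpos ζ).ne'
  have hUU : deriv (deriv U) ζ = d * deriv (fun s => U s * deriv V s / V s) ζ
      - 2 * τ * c / μ * deriv U ζ := by
    have h := (hG.hasDerivAt.const_mul d).sub
      ((hU' ζ).differentiableAt.hasDerivAt.const_mul (2 * τ * c / μ))
    have h2 := h.deriv
    rw [← h2]
    congr 1
  refine ⟨?_, ?_⟩
  · rw [hUU]
    generalize deriv (fun s => U s * deriv V s / V s) ζ = G
    rw [hd]
    field_simp
    ring
  · rw [(hV' ζ).deriv]
    field_simp
    ring
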